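/- Let U : ℝ³ → ℝ³ be continuously differentiable with div U = 0 everywhere, let b̄ ∈ ℝ with b̄ ≠ 0, and suppose curl(x ↦ (0,0,b̄) × U(x)) = 0 everywhere. Then ∂₃ U = 0 everywhere (U is independent of the third coordinate). If moreover U₃(x₁,x₂,0) = 0 for all (x₁,x₂) ∈ ℝ², then U₃ ≡ 0 on ℝ² × [0,1], so U takes the form U = (U₁, U₂, 0) with U₁, U₂ depending only on (x₁,x₂). -/

import Mathlib

/-- Partial derivative of a scalar field on `ℝ³` in the `i`-th coordinate direction. -/
noncomputable def pd3 (f : (Fin 3 → ℝ) → ℝ) (i : Fin 3) (x : Fin 3 → ℝ) : ℝ :=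
  fderiv ℝ f x (Pi.single i 1)

/-- The curl of a vector field on `ℝ³`:
`curl F = (∂₂F₃ − ∂₃F₂, ∂₃F₁ − ∂₁F₃, ∂₁F₂ − ∂₂F₁)`. -/
noncomputable def curl3 (F : (Fin 3 → ℝ) → (Fin 3 → ℝ)) (x : Fin 3 → ℝ) : Fin 3 → ℝ :=
  ![pd3 (fun y => F y 2) 1 x - pd3 (fun y => F y 1) 2 x,
    pd3 (fun y => F y 0) 2 x - pd3 (fun y => F y 2) 0 x,
    pd3 (fun y => F y 1) 0 x - pd3 (fun y => F y 0) 1 x]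

/-- The divergence of a vector field on `ℝ³`: `div F = ∂₁F₁ + ∂₂F₂ + ∂₃F₃`. -/
noncomputable def div3 (F : (Fin 3 → ℝ) → (Fin 3 → ℝ)) (x : Fin 3 → ℝ) : ℝ :=
  ∑ i, pd3 (fun y => F y i) i x

/-- The gradient of a scalar field on `ℝ³`. -/
noncomputable def grad3 (f : (Fin 3 → ℝ) → ℝ) (x : Fin 3 → ℝ) : Fin 3 → ℝ :=
  fun i => pd3 f i x

/-- Partial derivative of a scalar field on `ℝ²` in the `i`-th coordinate direction. -/
noncomputable def pd2 (f : (Fin 2 → ℝ) → ℝ) (i : Fin 2) (p : Fin 2 → ℝ) : ℝ :=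
  fderiv ℝ f p (Pi.single i 1)

theorem pd3_apply {U : (Fin 3 → ℝ) → (Fin 3 → ℝ)} {x : Fin 3 → ℝ}
    (hU : DifferentiableAt ℝ U x) (i j : Fin 3) :
    pd3 (fun y => U y i) j x = fderiv ℝ U x (Pi.single j 1) i := by
  have h := (hasFDerivAt_pi'.1 hU.hasFDerivAt i).fderiv
  simp [pd3, h]

theorem pd3_const_mul {f : (Fin 3 → ℝ) → ℝ} {x : Fin 3 → ℝ}
    (hf : DifferentiableAt ℝ f x) (c : ℝ) (i : Fin 3) :
    pd3 (fun y => c * f y) i x = c * pd3 f i x := by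
  simp [pd3, fderiv_const_mul hf]

theorem pd3_const (c : ℝ) (i : Fin 3) (x : Fin 3 → ℝ) : pd3 (fun _ => c) i x = 0 := by
  simp [pd3]

/-- The curl of `(0, 0, b) × U` in terms of the partial derivatives of `U`. -/
theorem curl3_vertical_cross {U : (Fin 3 → ℝ) → (Fin 3 → ℝ)} {x : Fin 3 → ℝ}
    (hU : DifferentiableAt ℝ U x) (b : ℝ) :
    curl3 (fun y => crossProduct ![0, 0, b] (U y)) x =
      ![-(b * pd3 (fun y => U y 0) 2 x), -(b * pd3 (fun y => U y 1) 2 x),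
        b * pd3 (fun y => U y 0) 0 x + b * pd3 (fun y => U y 1) 1 x] := by
  have hi (i : Fin 3) : DifferentiableAt ℝ (fun y => U y i) x := differentiableAt_pi.1 hU i
  have e0 : (fun y => crossProduct ![0, 0, b] (U y) 0) = fun y => -b * U y 1 := by
    ext y; simp [cross_apply]
  have e1 : (fun y => crossProduct ![0, 0, b] (U y) 1) = fun y => b * U y 0 := by
    ext y; simp [cross_apply]
  have e2 : (fun y => crossProduct ![0, 0, b] (U y) 2) = fun _ => 0 := by
    ext y; simp [cross_apply]
  simp only [curl3, e0, e1, e2, pd3_const_mul (hi _), pd3_const]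
  ext i
  fin_cases i <;> simp

/-- A differentiable field whose partial derivative in a coordinate direction vanishes is constant
along that direction. -/
theorem eq_update_of_fderiv_single_eq_zero {ι E : Type*} [Fintype ι] [DecidableEq ι]
    [NormedAddCommGroup E] [NormedSpace ℝ E] {U : (ι → ℝ) → E} (hU : Differentiable ℝ U) {i : ι}
    (h : ∀ x, fderiv ℝ U x (Pi.single i 1) = 0) (x : ι → ℝ) (t : ℝ) :
    U x = U (Function.update x i t) := by
  have hd (s : ℝ) : HasDerivAt (fun s => U (Function.update x i s)) 0 s := by
    have := (hU (Function.update x i s)).hasFDerivAt.comp_hasDerivAt s (hasDerivAt_update x i s)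
    rwa [h] at this
  simpa using is_const_of_deriv_eq_zero (fun s => (hd s).differentiableAt)
    (fun s => (hd s).deriv) (x i) t

/-- Let `U : ℝ³ → ℝ³` be continuously differentiable with `div U = 0`
everywhere, let `b̄ ≠ 0`, and suppose `curl(x ↦ (0,0,b̄) × U(x)) = 0` everywhere. Then
`∂₃U = 0` everywhere; if moreover `U₃(x₁,x₂,0) = 0` for all `(x₁,x₂)`, then `U₃ ≡ 0`
on `ℝ² × [0,1]`. -/
theorem statement7 (U : (Fin 3 → ℝ) → (Fin 3 → ℝ)) (hU : ContDiff ℝ 1 U)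
    (hdiv : ∀ x, div3 U x = 0) (bb : ℝ) (hbb : bb ≠ 0)
    (hcurl : ∀ x, curl3 (fun y => crossProduct ![0, 0, bb] (U y)) x = 0) :
    (∀ x, fderiv ℝ U x (Pi.single 2 1) = 0) ∧
    ((∀ x₁ x₂ : ℝ, U ![x₁, x₂, 0] 2 = 0) →
      ∀ x : Fin 3 → ℝ, x 2 ∈ Set.Icc (0:ℝ) 1 → U x 2 = 0) := by
  have hd : Differentiable ℝ U := hU.differentiable one_ne_zero
  have hz : ∀ x, fderiv ℝ U x (Pi.single 2 1) = 0 := by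
    intro x
    have hc := hcurl x
    rw [curl3_vertical_cross (hd x)] at hc
    have c0 := congrFun hc 0
    have c1 := congrFun hc 1
    have c2 := congrFun hc 2
    have hdx := hdiv x
    simp [hbb, ← mul_add] at c0 c1 c2
    simp only [div3, Fin.sum_univ_three] at hdx
    rw [c2, zero_add] at hdx
    rw [pd3_apply (hd x)] at c0 c1 hdx
    ext i
    fin_cases i
    exacts [c0, c1, hdx]
  refine ⟨hz, fun h0 x _ => ?_⟩
  have hx : Function.update x 2 0 = ![x 0, x 1, 0] := by
    ext i
    fin_cases i <;> simp [Function.update]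
  rw [eq_update_of_fderiv_single_eq_zero hd hz x 0, hx, h0]
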